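/- Let ν, μ be nonnegative integers with μ − ν even and nonnegative, let n ≥ 1, and let 0 < x_1 < ⋯ < x_n and w_1, …, w_n > 0 form an n-point Gaussian quadrature rule for w_{μ,ν}. Then for every polynomial f ∈ ℂ[x] of degree at most 4n + μ − 1 and every ω > 0, the Abel limit (H_ν f)(ω) exists and (H_ν f)(ω) = (Q_{2n,μ} f)(ω). -/

import Mathlib

open MeasureTheory Filter Set Polynomial
open scoped Classical

noncomputable section

/-- The Abel limit of `∫₀^∞ g(x) dx` is `L`: for every `s > 0` the integral
`∫₀^∞ e^{-s x} g(x) dx` converges and these integrals tend to `L` as `s → 0⁺`. -/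
def HasAbelLimit (g : ℝ → ℂ) (L : ℂ) : Prop :=
  (∀ s : ℝ, 0 < s →
    IntegrableOn (fun x : ℝ => Complex.exp (-(s : ℂ) * (x : ℂ)) * g x) (Set.Ioi 0)) ∧
  Tendsto (fun s : ℝ => ∫ x in Set.Ioi (0:ℝ), Complex.exp (-(s : ℂ) * (x : ℂ)) * g x)
    (nhdsWithin 0 (Set.Ioi 0)) (nhds L)

/-- Bessel function of the first kind of order `ν`, for `x > 0`, with the convention
`1/Γ(z) = 0` at nonpositive integers `z` (automatic since `Real.Gamma` vanishes there). -/
def besselJ (ν x : ℝ) : ℝ :=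
  ∑' k : ℕ, ((-1 : ℝ) ^ k / ((k.factorial : ℝ) * Real.Gamma (ν + k + 1))) *
    (x / 2) ^ (ν + 2 * (k : ℝ))

/-- Modified Bessel function of the second kind of order `ν`, for `x > 0`. -/
def besselK (ν x : ℝ) : ℝ :=
  ∫ t in Set.Ioi (0:ℝ), Real.exp (-x * Real.cosh t) * Real.cosh (ν * t)

/-- The weight function `w_{μ,ν}` on `(0,∞)`. -/
def weightW (μ ν : ℝ) (x : ℝ) : ℝ :=
  if ∃ m : ℤ, μ - ν = 2 * m then (1/2) * x ^ ((μ - 1)/2) * besselK ν (Real.sqrt x)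
  else (1/2) * x ^ (μ/2) * besselK ν (Real.sqrt x)

/-- `0 < x_1 < ⋯ < x_n` together with positive weights `w_1, …, w_n` form an `n`-point
Gaussian quadrature rule for `w_{μ,ν}`. -/
def IsGaussRule (μ ν : ℝ) (n : ℕ) (xs ws : Fin n → ℝ) : Prop :=
  StrictMono xs ∧ (∀ j, 0 < xs j) ∧ (∀ j, 0 < ws j) ∧
  ∀ p : Polynomial ℝ, p.natDegree ≤ 2 * n - 1 →
    ∑ j, ws j * p.eval (xs j) = ∫ x in Set.Ioi (0:ℝ), weightW μ ν x * p.eval x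

/-- `κ = μ` if `μ - ν` is even and `κ = μ + 1` if `μ - ν` is odd. -/
def kappaQ (μ ν : ℕ) : ℝ := if Even (μ - ν) then (μ : ℝ) else (μ : ℝ) + 1

/-- The boundary weights `ŵ_k⁰` of the generalized Gauss–Radau rule. -/
def wHat0 (μ ν : ℕ) {n : ℕ} (xs ws : Fin n → ℝ) (k : ℕ) : ℝ :=
  (1 / (k.factorial : ℝ)) *
    (2 ^ k * Real.Gamma (((ν : ℝ) + k + 1)/2) / Real.Gamma (((ν : ℝ) - k + 1)/2)
      - (2 / Real.pi) * Real.cos (((k : ℝ) - ν) * Real.pi / 2) *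
          ∑ j, ws j * (xs j) ^ (((k : ℝ) - kappaQ μ ν)/2))

/-- The generalized Gauss–Radau rule `(Q_{2n,μ} f)(ω)`. -/
def QRule (μ ν : ℕ) {n : ℕ} (xs ws : Fin n → ℝ) (f : ℂ → ℂ) (ω : ℝ) : ℂ :=
  (1 / (ω : ℂ)) *
    ((∑ k ∈ Finset.range μ, (wHat0 μ ν xs ws k : ℂ) / (ω : ℂ) ^ k * iteratedDeriv k f 0)
      + ∑ j, ((ws j * (xs j) ^ (-(kappaQ μ ν)/2) / Real.pi : ℝ) : ℂ) *
          (Complex.exp (-(ν : ℂ) * (Real.pi : ℂ) * Complex.I / 2) *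
              f (Complex.I * (Real.sqrt (xs j) : ℂ) / (ω : ℂ))
            + Complex.exp ((ν : ℂ) * (Real.pi : ℂ) * Complex.I / 2) *
              f (-Complex.I * (Real.sqrt (xs j) : ℂ) / (ω : ℂ))))

/-- `P` is a monic polynomial of degree `m` orthogonal with respect to `x^μ J_ν(x)`
on `(0,∞)`, all integrals taken in the Abel-limit sense. -/
def MonicOrthoBessel (μ ν : ℝ) (m : ℕ) (P : Polynomial ℂ) : Prop :=
  P.Monic ∧ P.natDegree = m ∧
  ∀ k < m, HasAbelLimit
    (fun x : ℝ => P.eval (x : ℂ) * ((x ^ ((k : ℝ) + μ) : ℝ) : ℂ) * (besselJ ν x : ℂ)) 0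

/-- `φ` is the monic real polynomial of degree `m` orthogonal to all lower powers
with respect to the weight `w_{μ,ν}` on `(0,∞)`. -/
def IsMonicOrthoW (μ ν : ℝ) (m : ℕ) (φ : Polynomial ℝ) : Prop :=
  φ.Monic ∧ φ.natDegree = m ∧
  ∀ k < m, ∫ x in Set.Ioi (0:ℝ), weightW μ ν x * φ.eval x * x ^ k = 0


/-! ### Bessel functions of natural order -/

/-- The entire function `y ↦ ∑ (-y)^k / (k! (ν + k)!)`. -/
def besselSeries (ν : ℕ) (y : ℝ) : ℝ :=
  ∑' k : ℕ, (-y) ^ k / ((k.factorial : ℝ) * ((ν + k).factorial : ℝ))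

/-- The Bessel function `J_ν` of natural order, as a function on all of `ℝ`. -/
def besselNat (ν : ℕ) (x : ℝ) : ℝ := (x / 2) ^ ν * besselSeries ν (x ^ 2 / 4)

lemma one_le_factorial_cast (m : ℕ) : (1 : ℝ) ≤ (m.factorial : ℝ) := by
  exact_mod_cast m.factorial_pos

lemma abs_besselSeries_term_le (ν k : ℕ) (y : ℝ) :
    ‖(-y) ^ k / ((k.factorial : ℝ) * ((ν + k).factorial : ℝ))‖ ≤ |y| ^ k / k.factorial := by
  have h := one_le_factorial_cast (ν + k)
  have h' := one_le_factorial_cast k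
  rw [norm_div, norm_pow, norm_neg, Real.norm_eq_abs, Real.norm_eq_abs,
    abs_of_pos (by positivity : (0 : ℝ) < (k.factorial : ℝ) * ((ν + k).factorial : ℝ))]
  gcongr
  nlinarith

lemma summable_besselSeries (ν : ℕ) (y : ℝ) :
    Summable fun k : ℕ => (-y) ^ k / ((k.factorial : ℝ) * ((ν + k).factorial : ℝ)) :=
  (Real.summable_pow_div_factorial |y|).of_norm_bounded
    fun k => abs_besselSeries_term_le ν k y

lemma hasDerivAt_besselSeries (ν : ℕ) (y : ℝ) :
    HasDerivAt (besselSeries ν) (-besselSeries (ν + 1) y) y := by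
  set R : ℝ := |y| + 1 with hR
  have hsum : Summable fun k : ℕ => (k : ℝ) * R ^ (k - 1) / k.factorial := by
    refine (summable_nat_add_iff 1).1 ((Real.summable_pow_div_factorial R).congr fun k => ?_)
    have := k.factorial_ne_zero
    have : (k.factorial : ℝ) ≠ 0 := by exact_mod_cast this
    rw [Nat.factorial_succ]
    push_cast
    field_simp
  have key := hasDerivAt_tsum_of_isPreconnected (𝕜 := ℝ) (F := ℝ) (t := Metric.ball 0 R)
    (g := fun (k : ℕ) y => (-y) ^ k / ((k.factorial : ℝ) * ((ν + k).factorial : ℝ)))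
    (g' := fun (k : ℕ) y =>
      ((k : ℝ) * (-y) ^ (k - 1) * (-1)) / ((k.factorial : ℝ) * ((ν + k).factorial : ℝ)))
    (y₀ := y) (y := y) hsum Metric.isOpen_ball (convex_ball _ _).isPreconnected
    (fun k z _ => ((hasDerivAt_neg z).pow k).div_const _)
    (fun k z hz => ?_) (by simp [hR]) (summable_besselSeries ν y) (by simp [hR])
  · have hval : ∑' k : ℕ, ((k : ℝ) * (-y) ^ (k - 1) * (-1)) /
        ((k.factorial : ℝ) * ((ν + k).factorial : ℝ)) = -besselSeries (ν + 1) y := by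
      have hs : Summable fun k : ℕ => ((k : ℝ) * (-y) ^ (k - 1) * (-1)) /
          ((k.factorial : ℝ) * ((ν + k).factorial : ℝ)) := by
        refine (summable_nat_add_iff 1).1 ((summable_besselSeries (ν + 1) y).neg.congr fun k => ?_)
        have : (k.factorial : ℝ) ≠ 0 := by exact_mod_cast k.factorial_ne_zero
        rw [Nat.factorial_succ, show ν + (k + 1) = ν + 1 + k by ring]
        push_cast
        field_simp
      rw [hs.tsum_eq_zero_add, besselSeries, ← tsum_neg]
      simp only [Nat.cast_zero, zero_mul, zero_div, zero_add]
      refine tsum_congr fun k => ?_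
      have : (k.factorial : ℝ) ≠ 0 := by exact_mod_cast k.factorial_ne_zero
      rw [Nat.factorial_succ, show ν + (k + 1) = ν + 1 + k by ring]
      push_cast
      field_simp
    rw [hval] at key
    exact key
  · have h := one_le_factorial_cast (ν + k)
    have h' := one_le_factorial_cast k
    rw [mem_ball_zero_iff, Real.norm_eq_abs] at hz
    rw [norm_div, norm_mul, norm_mul, norm_pow, norm_neg, norm_neg, norm_one, mul_one,
      Real.norm_natCast, Real.norm_eq_abs, Real.norm_eq_abs,
      abs_of_pos (by positivity : (0 : ℝ) < (k.factorial : ℝ) * ((ν + k).factorial : ℝ))]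
    gcongr
    nlinarith

/-- The contiguity relation of three consecutive `besselSeries`. -/
lemma besselSeries_contiguous (ν : ℕ) (y : ℝ) :
    besselSeries ν y + y * besselSeries (ν + 2) y = (ν + 1) * besselSeries (ν + 1) y := by
  have hs2 := (summable_besselSeries (ν + 2) y).mul_left y
  have hd : Summable fun k : ℕ => (ν + 1) * ((-y) ^ k /
      ((k.factorial : ℝ) * ((ν + 1 + k).factorial : ℝ))) -
      (-y) ^ k / ((k.factorial : ℝ) * ((ν + k).factorial : ℝ)) :=
    ((summable_besselSeries (ν + 1) y).mul_left _).sub (summable_besselSeries ν y)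
  have h : (ν + 1) * besselSeries (ν + 1) y - besselSeries ν y = y * besselSeries (ν + 2) y := by
    unfold besselSeries
    rw [← tsum_mul_left, ← tsum_mul_left,
      ← ((summable_besselSeries (ν + 1) y).mul_left _).tsum_sub (summable_besselSeries ν y),
      hd.tsum_eq_zero_add]
    have h0 : ((ν : ℝ) + 1) * ((-y) ^ 0 / (((0 : ℕ).factorial : ℝ) * ((ν + 1 + 0).factorial : ℝ))) -
      (-y) ^ 0 / (((0 : ℕ).factorial : ℝ) * ((ν + 0).factorial : ℝ)) = 0 := by
      have : (ν.factorial : ℝ) ≠ 0 := by exact_mod_cast ν.factorial_ne_zero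
      simp only [add_zero, Nat.factorial_succ, Nat.factorial_zero]
      push_cast
      have : (ν : ℝ) + 1 ≠ 0 := by positivity
      field_simp
      simp
    rw [h0, zero_add]
    refine tsum_congr fun k => ?_
    have h1 : (k.factorial : ℝ) ≠ 0 := by exact_mod_cast k.factorial_ne_zero
    have h2 : ((ν + 1 + k).factorial : ℝ) ≠ 0 := by exact_mod_cast (ν + 1 + k).factorial_ne_zero
    rw [show ν + 1 + (k + 1) = (ν + 1 + k) + 1 by ring, show ν + 2 + k = (ν + 1 + k) + 1 by ring,
      show ν + (k + 1) = ν + 1 + k by ring, Nat.factorial_succ (ν + 1 + k), Nat.factorial_succ k]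
    push_cast
    have h3 : (ν : ℝ) + 1 + k + 1 ≠ 0 := by positivity
    have h4 : (k : ℝ) + 1 ≠ 0 := by positivity
    field_simp
    ring
  linarith

lemma besselJ_natCast (ν : ℕ) (x : ℝ) : besselJ ν x = besselNat ν x := by
  unfold besselJ besselNat besselSeries
  rw [← tsum_mul_left]
  refine tsum_congr fun k => ?_
  have hG : Real.Gamma ((ν : ℝ) + k + 1) = ((ν + k).factorial : ℝ) := by
    rw [← Real.Gamma_nat_eq_factorial]; push_cast; rfl
  have hp : (x / 2) ^ ((ν : ℝ) + 2 * (k : ℝ)) = (x / 2) ^ (ν + 2 * k) := by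
    rw [← Real.rpow_natCast]; push_cast; rfl
  rw [hG, hp, pow_add, pow_mul, show (x / 2) ^ 2 = x ^ 2 / 4 by ring,
    neg_pow (x ^ 2 / 4)]
  ring

lemma besselNat_three_term (ν : ℕ) (x : ℝ) :
    x * (besselNat ν x + besselNat (ν + 2) x) = 2 * (ν + 1) * besselNat (ν + 1) x := by
  have h := besselSeries_contiguous ν (x ^ 2 / 4)
  unfold besselNat
  linear_combination (x * (x / 2) ^ ν) * h

lemma hasDerivAt_besselSeries_sq (ν : ℕ) (x : ℝ) :
    HasDerivAt (fun x : ℝ => besselSeries ν (x ^ 2 / 4))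
      (-besselSeries (ν + 1) (x ^ 2 / 4) * (x / 2)) x := by
  have h : HasDerivAt (fun x : ℝ => x ^ 2 / 4) (x / 2) x := by
    refine ((hasDerivAt_pow 2 x).div_const 4).congr_deriv ?_
    norm_num
    ring
  exact (hasDerivAt_besselSeries ν (x ^ 2 / 4)).comp x h

lemma hasDerivAt_besselNat_zero (x : ℝ) :
    HasDerivAt (besselNat 0) (-besselNat 1 x) x := by
  have h := hasDerivAt_besselSeries_sq 0 x
  have e : besselNat 0 = fun x : ℝ => besselSeries 0 (x ^ 2 / 4) := by
    funext x; simp [besselNat]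
  rw [e]
  refine h.congr_deriv ?_
  unfold besselNat
  ring

lemma hasDerivAt_besselNat_succ (ν : ℕ) (x : ℝ) :
    HasDerivAt (besselNat (ν + 1)) ((besselNat ν x - besselNat (ν + 2) x) / 2) x := by
  have h1 : HasDerivAt (fun x : ℝ => (x / 2) ^ (ν + 1)) ((ν + 1) * (x / 2) ^ ν * (1 / 2)) x := by
    refine (((hasDerivAt_id x).div_const 2).pow (ν + 1)).congr_deriv ?_
    simp
  have h2 := h1.mul (hasDerivAt_besselSeries_sq (ν + 1) x)
  have h := besselSeries_contiguous ν (x ^ 2 / 4)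
  change HasDerivAt (fun x => (x / 2) ^ (ν + 1) * besselSeries (ν + 1) (x ^ 2 / 4)) _ x
  refine h2.congr_deriv ?_
  rw [show ν + 1 + 1 = ν + 2 from rfl]
  unfold besselNat
  linear_combination (-(x / 2) ^ ν / 2) * h

lemma continuous_besselNat (ν : ℕ) : Continuous (besselNat ν) := by
  refine continuous_iff_continuousAt.2 fun x => ?_
  cases ν with
  | zero => exact (hasDerivAt_besselNat_zero x).continuousAt
  | succ ν => exact (hasDerivAt_besselNat_succ ν x).continuousAt

lemma besselNat_zero_zero : besselNat 0 0 = 1 := by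
  have : besselSeries 0 0 = 1 := by
    unfold besselSeries
    rw [tsum_eq_single 0 (fun k hk => by simp [hk])]
    simp
  simp [besselNat, this]

lemma besselNat_succ_zero (ν : ℕ) : besselNat (ν + 1) 0 = 0 := by simp [besselNat]

lemma besselNat_sq_add_sq_le_one {x : ℝ} (hx : 0 ≤ x) :
    besselNat 0 x ^ 2 + besselNat 1 x ^ 2 ≤ 1 := by
  have hd : ∀ x, HasDerivAt (fun x => besselNat 0 x ^ 2 + besselNat 1 x ^ 2)
      (2 * besselNat 0 x * (-besselNat 1 x) +
        2 * besselNat 1 x * ((besselNat 0 x - besselNat 2 x) / 2)) x := by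
    intro x
    refine (((hasDerivAt_besselNat_zero x).pow 2).add
      ((hasDerivAt_besselNat_succ 0 x).pow 2)).congr_deriv ?_
    simp
  have hanti : AntitoneOn (fun x => besselNat 0 x ^ 2 + besselNat 1 x ^ 2) (Ici 0) := by
    refine antitoneOn_of_deriv_nonpos (convex_Ici 0)
      (fun x _ => (hd x).continuousAt.continuousWithinAt)
      (fun x _ => (hd x).differentiableAt.differentiableWithinAt) fun x hx => ?_
    rw [interior_Ici, mem_Ioi] at hx
    rw [(hd x).deriv]
    have h3 := besselNat_three_term 0 x
    norm_num at h3
    have h4 : x * (besselNat 1 x * (besselNat 0 x + besselNat 2 x)) ≥ 0 := by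
      have : x * (besselNat 1 x * (besselNat 0 x + besselNat 2 x)) = 2 * besselNat 1 x ^ 2 := by
        linear_combination besselNat 1 x * h3
      rw [this]
      positivity
    have h5 := nonneg_of_mul_nonneg_right h4 hx
    linarith
  have := hanti (mem_Ici.2 le_rfl) (mem_Ici.2 hx) hx
  simpa [besselNat_zero_zero, besselNat_succ_zero 0] using this

lemma exists_abs_besselNat_le (ν : ℕ) : ∃ C, ∀ x, 0 ≤ x → |besselNat ν x| ≤ C := by
  induction ν using Nat.twoStepInduction with
  | zero =>
    refine ⟨1, fun x hx => ?_⟩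
    have := besselNat_sq_add_sq_le_one hx
    exact abs_le_one_iff_mul_self_le_one.2 (by nlinarith [sq_nonneg (besselNat 1 x)])
  | one =>
    refine ⟨1, fun x hx => ?_⟩
    have := besselNat_sq_add_sq_le_one hx
    exact abs_le_one_iff_mul_self_le_one.2 (by nlinarith [sq_nonneg (besselNat 0 x)])
  | more ν h0 h1 =>
    obtain ⟨C0, h0⟩ := h0
    obtain ⟨C1, h1⟩ := h1
    obtain ⟨D, hD⟩ := (isCompact_Icc (a := (0 : ℝ)) (b := 1)).exists_bound_of_continuousOn
      (continuous_besselNat (ν + 2)).continuousOn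
    refine ⟨max D (2 * (ν + 1) * C1 + C0), fun x hx => ?_⟩
    rcases le_total x 1 with hx1 | hx1
    · exact le_max_of_le_left (hD x ⟨hx, hx1⟩)
    · refine le_max_of_le_right ?_
      have h3 := besselNat_three_term ν x
      have hx0 : x ≠ 0 := by positivity
      have h4 : besselNat (ν + 2) x = 2 * (ν + 1) * besselNat (ν + 1) x / x - besselNat ν x := by
        field_simp
        linarith
      have h5 : |2 * (ν + 1) * besselNat (ν + 1) x / x| ≤ 2 * (ν + 1) * C1 := by
        rw [abs_div, abs_mul, abs_of_nonneg hx, abs_of_nonneg (by positivity : (0 : ℝ) ≤ 2 * (ν + 1))]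
        refine (div_le_self (by positivity) hx1).trans ?_
        gcongr
        exact h1 x hx
      rw [h4]
      exact (abs_sub _ _).trans (add_le_add h5 (h0 x hx))

/-! ### Laplace moments -/

/-- The Laplace moment `∫₀^∞ e^{-sx} x^k h(x) dx`. -/
def laplaceMoment (h : ℝ → ℝ) (k : ℕ) (s : ℝ) : ℝ :=
  ∫ x in Ioi (0 : ℝ), Real.exp (-s * x) * x ^ k * h x

lemma integrableOn_exp_mul_pow (k : ℕ) {s : ℝ} (hs : 0 < s) :
    IntegrableOn (fun x : ℝ => Real.exp (-s * x) * x ^ k) (Ioi 0) := by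
  have hk : (-1 : ℝ) < k := by
    have : (0 : ℝ) ≤ k := k.cast_nonneg
    linarith
  refine (integrableOn_rpow_mul_exp_neg_mul_rpow hk one_pos hs).congr_fun
    (fun x _ => ?_) measurableSet_Ioi
  simp only [Real.rpow_natCast, Real.rpow_one]
  ring

lemma integrableOn_laplace {h : ℝ → ℝ} (hc : Continuous h) (hb : ∃ C, ∀ x, 0 ≤ x → |h x| ≤ C)
    (k : ℕ) {s : ℝ} (hs : 0 < s) :
    IntegrableOn (fun x : ℝ => Real.exp (-s * x) * x ^ k * h x) (Ioi 0) := by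
  obtain ⟨C, hC⟩ := hb
  refine (integrableOn_exp_mul_pow k hs).mul_bdd (c := C)
    hc.aestronglyMeasurable ?_
  exact (ae_restrict_mem measurableSet_Ioi).mono fun x hx => hC x (le_of_lt hx)

lemma tendsto_exp_mul_pow_mul_atTop {h : ℝ → ℝ} (hb : ∃ C, ∀ x, 0 ≤ x → |h x| ≤ C)
    (k : ℕ) {s : ℝ} (hs : 0 < s) :
    Tendsto (fun x : ℝ => Real.exp (-s * x) * x ^ k * h x) atTop (nhds 0) := by
  obtain ⟨C, hC⟩ := hb
  have h0 : Tendsto (fun x : ℝ => Real.exp (-s * x) * x ^ k) atTop (nhds 0) := by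
    refine (tendsto_rpow_mul_exp_neg_mul_atTop_nhds_zero (k : ℝ) s hs).congr fun x => ?_
    rw [Real.rpow_natCast]
    ring
  refine h0.zero_mul_isBoundedUnder_le ⟨C, ?_⟩
  rw [eventually_map]
  exact (eventually_ge_atTop 0).mono fun x hx => hC x hx

/-- Integration by parts for Laplace moments. -/
lemma laplaceMoment_deriv {h h' : ℝ → ℝ} (hd : ∀ x, HasDerivAt h (h' x) x)
    (hc' : Continuous h') (hb : ∃ C, ∀ x, 0 ≤ x → |h x| ≤ C)
    (hb' : ∃ C, ∀ x, 0 ≤ x → |h' x| ≤ C) (k : ℕ) {s : ℝ} (hs : 0 < s) :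
    laplaceMoment h' k s =
      s * laplaceMoment h k s - k * laplaceMoment h (k - 1) s - 0 ^ k * h 0 := by
  have hc : Continuous h := continuous_iff_continuousAt.2 fun x => (hd x).continuousAt
  have i1 := (integrableOn_laplace hc hb k hs).const_mul (-s)
  have i2 := (integrableOn_laplace hc hb (k - 1) hs).const_mul (k : ℝ)
  have i3 := integrableOn_laplace hc' hb' k hs
  have hder : ∀ x ∈ Ioi (0 : ℝ), HasDerivAt (fun x => Real.exp (-s * x) * x ^ k * h x)
      (-s * (Real.exp (-s * x) * x ^ k * h x) + k * (Real.exp (-s * x) * x ^ (k - 1) * h x) +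
        Real.exp (-s * x) * x ^ k * h' x) x := by
    intro x _
    have he : HasDerivAt (fun x => Real.exp (-s * x)) (Real.exp (-s * x) * (-s)) x := by
      simpa using ((hasDerivAt_id x).const_mul (-s)).exp
    refine ((he.mul (hasDerivAt_pow k x)).mul (hd x)).congr_deriv ?_
    simp only [Pi.mul_apply]
    ring
  have key := integral_Ioi_of_hasDerivAt_of_tendsto
    (by fun_prop : Continuous fun x => Real.exp (-s * x) * x ^ k * h x).continuousWithinAt
    hder ((i1.add i2).add i3) (tendsto_exp_mul_pow_mul_atTop hb k hs)
  have e := integral_add (i1.add i2) i3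
  have e' := integral_add i1 i2
  simp only [Pi.add_apply] at e
  rw [e, e', integral_const_mul, integral_const_mul] at key
  simp only [mul_zero, Real.exp_zero, one_mul, zero_sub] at key
  unfold laplaceMoment
  linarith

lemma laplaceMoment_sub {h₁ h₂ : ℝ → ℝ} (hc₁ : Continuous h₁) (hc₂ : Continuous h₂)
    (hb₁ : ∃ C, ∀ x, 0 ≤ x → |h₁ x| ≤ C) (hb₂ : ∃ C, ∀ x, 0 ≤ x → |h₂ x| ≤ C)
    (k : ℕ) {s : ℝ} (hs : 0 < s) :
    laplaceMoment (fun x => (h₁ x - h₂ x) / 2) k s =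
      (laplaceMoment h₁ k s - laplaceMoment h₂ k s) / 2 := by
  unfold laplaceMoment
  rw [← integral_sub (integrableOn_laplace hc₁ hb₁ k hs) (integrableOn_laplace hc₂ hb₂ k hs),
    ← integral_div]
  refine integral_congr_ae (.of_forall fun x => ?_)
  simp only
  ring

lemma exists_abs_half_sub_le {h₁ h₂ : ℝ → ℝ}
    (hb₁ : ∃ C, ∀ x, 0 ≤ x → |h₁ x| ≤ C) (hb₂ : ∃ C, ∀ x, 0 ≤ x → |h₂ x| ≤ C) :
    ∃ C, ∀ x, 0 ≤ x → |(h₁ x - h₂ x) / 2| ≤ C := by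
  obtain ⟨C₁, h1⟩ := hb₁
  obtain ⟨C₂, h2⟩ := hb₂
  refine ⟨(C₁ + C₂) / 2, fun x hx => ?_⟩
  rw [abs_div, abs_two]
  gcongr
  exact (abs_sub _ _).trans (add_le_add (h1 x hx) (h2 x hx))

lemma laplaceMoment_besselNat_one (k : ℕ) {s : ℝ} (hs : 0 < s) :
    laplaceMoment (besselNat 1) k s =
      0 ^ k - s * laplaceMoment (besselNat 0) k s +
        k * laplaceMoment (besselNat 0) (k - 1) s := by
  have h := laplaceMoment_deriv hasDerivAt_besselNat_zero (continuous_besselNat 1).neg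
    (exists_abs_besselNat_le 0) (by simpa only [abs_neg] using exists_abs_besselNat_le 1) k hs
  have hneg : laplaceMoment (fun x => -besselNat 1 x) k s = -laplaceMoment (besselNat 1) k s := by
    unfold laplaceMoment
    rw [← integral_neg]
    simp only [mul_neg]
  rw [hneg, besselNat_zero_zero] at h
  linarith

lemma laplaceMoment_besselNat_add_two (ν k : ℕ) {s : ℝ} (hs : 0 < s) :
    laplaceMoment (besselNat (ν + 2)) k s =
      laplaceMoment (besselNat ν) k s - 2 * s * laplaceMoment (besselNat (ν + 1)) k s +
        2 * k * laplaceMoment (besselNat (ν + 1)) (k - 1) s := by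
  have h := laplaceMoment_deriv (hasDerivAt_besselNat_succ ν)
    (((continuous_besselNat ν).sub (continuous_besselNat (ν + 2))).div_const 2)
    (exists_abs_besselNat_le (ν + 1))
    (exists_abs_half_sub_le (exists_abs_besselNat_le ν) (exists_abs_besselNat_le (ν + 2))) k hs
  rw [laplaceMoment_sub (continuous_besselNat ν) (continuous_besselNat (ν + 2))
    (exists_abs_besselNat_le ν) (exists_abs_besselNat_le (ν + 2)) k hs,
    besselNat_succ_zero] at h
  linarith

/-- The Laplace-transformed form of `x (J₀ + J₂) = 2 J₁`. -/
lemma laplaceMoment_besselNat_three_term (k : ℕ) {s : ℝ} (hs : 0 < s) :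
    laplaceMoment (besselNat 0) (k + 1) s + laplaceMoment (besselNat 2) (k + 1) s =
      2 * laplaceMoment (besselNat 1) k s := by
  unfold laplaceMoment
  rw [← integral_add
    (integrableOn_laplace (continuous_besselNat 0) (exists_abs_besselNat_le 0) (k + 1) hs)
    (integrableOn_laplace (continuous_besselNat 2) (exists_abs_besselNat_le 2) (k + 1) hs),
    ← integral_const_mul]
  refine integral_congr_ae (.of_forall fun x => ?_)
  have h := besselNat_three_term 0 x
  norm_num at h
  simp only
  linear_combination Real.exp (-s * x) * x ^ k * h

lemma laplaceMoment_besselNat_zero_rec (k : ℕ) {s : ℝ} (hs : 0 < s) :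
    (1 + s ^ 2) * laplaceMoment (besselNat 0) (k + 1) s =
      (2 * k + 1) * s * laplaceMoment (besselNat 0) k s -
        k ^ 2 * laplaceMoment (besselNat 0) (k - 1) s := by
  have h1 := laplaceMoment_besselNat_one k hs
  have h2 := laplaceMoment_besselNat_one (k + 1) hs
  have h3 := laplaceMoment_besselNat_add_two 0 (k + 1) hs
  have h4 := laplaceMoment_besselNat_three_term k hs
  have h0 : (k : ℝ) * 0 ^ k = 0 := by cases k <;> simp
  simp only [zero_add, add_tsub_cancel_right, pow_succ, mul_zero, zero_sub] at h2 h3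
  push_cast at h2 h3
  linear_combination (1 / 2 : ℝ) * h4 - (1 / 2 : ℝ) * h3 + s * h2 - k * h1 - h0

lemma hasDerivAt_laplaceMoment {h : ℝ → ℝ} (hc : Continuous h)
    (hb : ∃ C, ∀ x, 0 ≤ x → |h x| ≤ C) (k : ℕ) {s : ℝ} (hs : 0 < s) :
    HasDerivAt (laplaceMoment h k) (-laplaceMoment h (k + 1) s) s := by
  have hs2 : 0 < s / 2 := by positivity
  have key := (hasDerivAt_integral_of_dominated_loc_of_deriv_le (𝕜 := ℝ) (E := ℝ)
    (μ := volume.restrict (Ioi (0 : ℝ))) (s := Ioi (s / 2)) (x₀ := s)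
    (F := fun s x => Real.exp (-s * x) * x ^ k * h x)
    (F' := fun s x => -(Real.exp (-s * x) * x ^ (k + 1) * h x))
    (bound := fun x => |Real.exp (-(s / 2) * x) * x ^ (k + 1) * h x|)
    (Ioi_mem_nhds (by linarith))
    (.of_forall fun s => (by fun_prop :
      Continuous fun x => Real.exp (-s * x) * x ^ k * h x).aestronglyMeasurable)
    (integrableOn_laplace hc hb k hs)
    (by fun_prop : Continuous fun x =>
      -(Real.exp (-s * x) * x ^ (k + 1) * h x)).aestronglyMeasurable
    ((ae_restrict_mem measurableSet_Ioi).mono fun x hx t ht => ?_)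
    (integrableOn_laplace hc hb (k + 1) hs2).abs
    (.of_forall fun x t _ => ?_)).2
  · rw [integral_neg] at key
    exact key
  · rw [mem_Ioi] at hx ht
    rw [norm_neg, Real.norm_eq_abs, abs_mul, abs_mul, abs_mul, abs_mul, Real.abs_exp, Real.abs_exp]
    gcongr
  · have he : HasDerivAt (fun t => Real.exp (-t * x)) (Real.exp (-t * x) * (-1 * x)) t :=
      ((hasDerivAt_neg t).mul_const x).exp
    refine ((he.mul_const (x ^ k)).mul_const (h x)).congr_deriv ?_
    ring

lemma abs_laplaceMoment_zero_le {h : ℝ → ℝ} {C : ℝ} (hb : ∀ x, 0 ≤ x → |h x| ≤ C) {s : ℝ}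
    (hs : 0 < s) : |laplaceMoment h 0 s| ≤ C / s := by
  have hi := (integrableOn_exp_mul_Ioi (neg_lt_zero.2 hs) 0).const_mul C
  have := norm_integral_le_of_norm_le (f := fun x => Real.exp (-s * x) * x ^ 0 * h x) hi
    ((ae_restrict_mem measurableSet_Ioi).mono fun x hx => by
      rw [pow_zero, mul_one, norm_mul, Real.norm_eq_abs, Real.abs_exp, mul_comm]
      gcongr
      exact hb x (le_of_lt hx))
  rw [integral_const_mul, integral_exp_mul_Ioi (neg_lt_zero.2 hs)] at this
  simpa [laplaceMoment, div_eq_mul_inv] using this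

lemma laplaceMoment_besselNat_zero_zero {s : ℝ} (hs : 0 < s) :
    laplaceMoment (besselNat 0) 0 s = 1 / Real.sqrt (1 + s ^ 2) := by
  set P := laplaceMoment (besselNat 0) 0 with hP
  have hd : ∀ t : ℝ, 0 < t → HasDerivAt (fun t => Real.sqrt (1 + t ^ 2) * P t) 0 t := by
    intro t ht
    have h1 : HasDerivAt (fun t : ℝ => 1 + t ^ 2) (2 * t) t := by
      simpa using (hasDerivAt_pow 2 t).const_add 1
    have hpos : 0 < 1 + t ^ 2 := by positivity
    have h2 := h1.sqrt hpos.ne'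
    refine (h2.mul (hasDerivAt_laplaceMoment (continuous_besselNat 0)
      (exists_abs_besselNat_le 0) 0 ht)).congr_deriv ?_
    have h3 := laplaceMoment_besselNat_zero_rec 0 ht
    simp only [Nat.cast_zero] at h3
    have hsq := Real.sq_sqrt hpos.le
    have hs0 : Real.sqrt (1 + t ^ 2) ≠ 0 := (Real.sqrt_pos.2 hpos).ne'
    field_simp
    rw [hsq]
    simp only [zero_add] at h3 ⊢
    rw [← hP] at h3
    linear_combination -h3
  have hconst : ∀ t : ℝ, 0 < t → Real.sqrt (1 + t ^ 2) * P t = Real.sqrt (1 + s ^ 2) * P s := by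
    intro t ht
    exact isOpen_Ioi.is_const_of_deriv_eq_zero (s := Ioi (0 : ℝ)) isPreconnected_Ioi
      (fun u hu => (hd u hu).differentiableAt.differentiableWithinAt)
      (fun u hu => (hd u hu).deriv) (mem_Ioi.2 ht) (mem_Ioi.2 hs)
  obtain ⟨C₀, hC₀⟩ := exists_abs_besselNat_le 0
  obtain ⟨C₁, hC₁⟩ := exists_abs_besselNat_le 1
  have hinv : ∀ C : ℝ, Tendsto (fun t : ℝ => C / t) atTop (nhds 0) := fun C =>
    tendsto_const_nhds.div_atTop tendsto_id
  have hP0 : Tendsto P atTop (nhds 0) :=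
    squeeze_zero_norm' ((eventually_gt_atTop 0).mono fun t ht =>
      abs_laplaceMoment_zero_le hC₀ ht) (hinv C₀)
  have hR0 : Tendsto (laplaceMoment (besselNat 1) 0) atTop (nhds 0) :=
    squeeze_zero_norm' ((eventually_gt_atTop 0).mono fun t ht =>
      abs_laplaceMoment_zero_le hC₁ ht) (hinv C₁)
  have htP : Tendsto (fun t => t * P t) atTop (nhds 1) := by
    have : Tendsto (fun t => 1 - laplaceMoment (besselNat 1) 0 t) atTop (nhds (1 - 0)) :=
      tendsto_const_nhds.sub hR0
    rw [sub_zero] at this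
    refine this.congr' ((eventually_gt_atTop 0).mono fun t ht => ?_)
    have := laplaceMoment_besselNat_one 0 ht
    simp only [pow_zero, Nat.cast_zero, zero_mul, add_zero] at this
    rw [this]
    ring
  have hlim : Tendsto (fun t => (Real.sqrt (1 + t ^ 2) * P t) ^ 2) atTop (nhds 1) := by
    have := (hP0.pow 2).add (htP.pow 2)
    norm_num at this
    refine this.congr fun t => ?_
    rw [mul_pow (Real.sqrt _), Real.sq_sqrt (by positivity)]
    ring
  have hsq : (Real.sqrt (1 + s ^ 2) * P s) ^ 2 = 1 :=
    tendsto_nhds_unique (tendsto_const_nhds.congr'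
      ((eventually_gt_atTop 0).mono fun t ht => by rw [hconst t ht])) hlim
  have hpos : 0 ≤ Real.sqrt (1 + s ^ 2) * P s := by
    obtain ⟨t, ht, ht0⟩ := ((htP.eventually (lt_mem_nhds (show (0 : ℝ) < 1 by norm_num))).and
      (eventually_gt_atTop 0)).exists
    rw [← hconst t ht0]
    have : 0 < P t := pos_of_mul_pos_right ht ht0.le
    positivity
  have h1 : Real.sqrt (1 + s ^ 2) * P s = 1 := by
    nlinarith
  have : Real.sqrt (1 + s ^ 2) ≠ 0 := (Real.sqrt_pos.2 (by positivity)).ne'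
  field_simp
  linarith

/-! ### Moments of `J_ν` in the Abel sense -/

/-- The `k`-th moment of `J_ν` in the Abel sense. -/
def besselMoment (ν k : ℕ) : ℝ :=
  2 ^ k * Real.Gamma (((ν : ℝ) + k + 1) / 2) / Real.Gamma (((ν : ℝ) - k + 1) / 2)

lemma inv_Gamma_eq_mul_inv_Gamma_add_one (b : ℝ) :
    (Real.Gamma b)⁻¹ = b * (Real.Gamma (b + 1))⁻¹ := by
  rcases eq_or_ne b 0 with rfl | hb
  · simp [Real.Gamma_zero]
  · rw [Real.Gamma_add_one hb, mul_inv, ← mul_assoc, mul_inv_cancel₀ hb, one_mul]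

lemma besselMoment_zero_right (ν : ℕ) : besselMoment ν 0 = 1 := by
  have : Real.Gamma (((ν : ℝ) + 1) / 2) ≠ 0 := (Real.Gamma_pos_of_pos (by positivity)).ne'
  simp [besselMoment, this]

lemma besselMoment_add_two (ν k : ℕ) :
    besselMoment (ν + 2) k = besselMoment ν k + 2 * k * besselMoment (ν + 1) (k - 1) := by
  cases k with
  | zero => simp [besselMoment_zero_right]
  | succ k =>
    simp only [besselMoment, add_tsub_cancel_right]
    push_cast
    have ha := Real.Gamma_add_one (s := ((ν : ℝ) + k + 2) / 2) (by positivity)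
    have hb := inv_Gamma_eq_mul_inv_Gamma_add_one (((ν : ℝ) - k) / 2)
    rw [show ((ν : ℝ) + 2 + (k + 1) + 1) / 2 = ((ν : ℝ) + k + 2) / 2 + 1 by ring,
      show ((ν : ℝ) + 2 - (k + 1) + 1) / 2 = ((ν : ℝ) - k) / 2 + 1 by ring,
      show ((ν : ℝ) + (k + 1) + 1) / 2 = ((ν : ℝ) + k + 2) / 2 by ring,
      show ((ν : ℝ) - (k + 1) + 1) / 2 = ((ν : ℝ) - k) / 2 by ring,
      show ((ν : ℝ) + 1 + k + 1) / 2 = ((ν : ℝ) + k + 2) / 2 by ring,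
      show ((ν : ℝ) + 1 - k + 1) / 2 = ((ν : ℝ) - k) / 2 + 1 by ring,
      ha, div_eq_mul_inv _ (Real.Gamma (((ν : ℝ) - k) / 2)), hb]
    ring

lemma besselMoment_one (k : ℕ) :
    besselMoment 1 k = 0 ^ k + k * besselMoment 0 (k - 1) := by
  cases k with
  | zero => simp [besselMoment_zero_right]
  | succ k =>
    simp only [besselMoment, add_tsub_cancel_right]
    push_cast
    have ha := Real.Gamma_add_one (s := ((k : ℝ) + 1) / 2) (by positivity)
    rw [show (1 + ((k : ℝ) + 1) + 1) / 2 = ((k : ℝ) + 1) / 2 + 1 by ring,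
      show (1 - ((k : ℝ) + 1) + 1) / 2 = (0 - (k : ℝ) + 1) / 2 by ring, zero_add, ha]
    simp only [ne_eq, Nat.add_eq_zero_iff, one_ne_zero, and_false, not_false_eq_true, zero_pow,
      zero_add]
    ring

lemma besselMoment_zero_succ (k : ℕ) :
    besselMoment 0 (k + 1) = -(k : ℝ) ^ 2 * besselMoment 0 (k - 1) := by
  cases k with
  | zero => simp [besselMoment, Real.Gamma_zero]
  | succ k =>
    simp only [besselMoment, add_tsub_cancel_right]
    push_cast
    have ha := Real.Gamma_add_one (s := ((k : ℝ) + 1) / 2) (by positivity)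
    have hb := inv_Gamma_eq_mul_inv_Gamma_add_one ((-(k : ℝ) - 1) / 2)
    rw [show (0 + ((k : ℝ) + 1 + 1) + 1) / 2 = ((k : ℝ) + 1) / 2 + 1 by ring,
      show (0 - ((k : ℝ) + 1 + 1) + 1) / 2 = (-(k : ℝ) - 1) / 2 by ring,
      show (0 - (k : ℝ) + 1) / 2 = (-(k : ℝ) - 1) / 2 + 1 by ring, zero_add, ha,
      div_eq_mul_inv, div_eq_mul_inv, hb]
    ring

lemma tendsto_id_nhdsGT_zero : Tendsto (fun s : ℝ => s) (nhdsWithin 0 (Ioi 0)) (nhds 0) :=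
  tendsto_nhdsWithin_of_tendsto_nhds tendsto_id

lemma tendsto_laplaceMoment_besselNat_zero (k : ℕ) :
    Tendsto (laplaceMoment (besselNat 0) k) (nhdsWithin 0 (Ioi 0))
      (nhds (besselMoment 0 k)) := by
  have hpos : ∀ᶠ s : ℝ in nhdsWithin 0 (Ioi 0), 0 < s := eventually_mem_nhdsWithin
  induction k using Nat.strong_induction_on with
  | _ k ih =>
    cases k with
    | zero =>
      rw [besselMoment_zero_right]
      have h : ContinuousAt (fun s : ℝ => 1 / Real.sqrt (1 + s ^ 2)) 0 := by
        refine ContinuousAt.div (by fun_prop) (by fun_prop) (by simp)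
      have h' := tendsto_nhdsWithin_of_tendsto_nhds (s := Ioi (0 : ℝ)) h.tendsto
      norm_num at h'
      refine h'.congr' (hpos.mono fun s hs => ?_)
      rw [laplaceMoment_besselNat_zero_zero hs, one_div]
    | succ k =>
      have h1 := ih k (by lia)
      have h2 := ih (k - 1) (by lia)
      have hs := tendsto_id_nhdsGT_zero
      have hlim := (((hs.const_mul (2 * (k : ℝ) + 1)).mul h1).sub
        (h2.const_mul ((k : ℝ) ^ 2))).div ((hs.pow 2).const_add 1) (by norm_num)
      have hval : ((2 * (k : ℝ) + 1) * 0 * besselMoment 0 k -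
          (k : ℝ) ^ 2 * besselMoment 0 (k - 1)) / (1 + 0 ^ 2) = besselMoment 0 (k + 1) := by
        rw [besselMoment_zero_succ]
        ring
      rw [hval] at hlim
      refine hlim.congr' (hpos.mono fun s hs => ?_)
      have hne : 1 + s ^ 2 ≠ 0 := by positivity
      have := laplaceMoment_besselNat_zero_rec k hs
      simp only [Pi.div_apply]
      rw [div_eq_iff hne]
      linarith

/-- The Laplace moments of `J_ν` tend to the Abel moments. -/
lemma tendsto_laplaceMoment_besselNat (ν k : ℕ) :
    Tendsto (laplaceMoment (besselNat ν) k) (nhdsWithin 0 (Ioi 0))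
      (nhds (besselMoment ν k)) := by
  have hpos : ∀ᶠ s : ℝ in nhdsWithin 0 (Ioi 0), 0 < s := eventually_mem_nhdsWithin
  have hs := tendsto_id_nhdsGT_zero
  induction ν using Nat.twoStepInduction generalizing k with
  | zero => exact tendsto_laplaceMoment_besselNat_zero k
  | one =>
    have hlim := ((hs.mul (tendsto_laplaceMoment_besselNat_zero k)).const_sub (0 ^ k)).add
      ((tendsto_laplaceMoment_besselNat_zero (k - 1)).const_mul (k : ℝ))
    rw [zero_mul, sub_zero, ← besselMoment_one] at hlim
    exact hlim.congr' (hpos.mono fun s hs => (laplaceMoment_besselNat_one k hs).symm)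
  | more ν h0 h1 =>
    have hlim := ((h0 k).sub ((hs.const_mul 2).mul (h1 k))).add
      ((h1 (k - 1)).const_mul (2 * (k : ℝ)))
    rw [mul_zero, zero_mul, sub_zero, ← besselMoment_add_two] at hlim
    exact hlim.congr' (hpos.mono fun s hs => (laplaceMoment_besselNat_add_two ν k hs).symm)

/-! ### Moments of `K_ν` -/

/-- The integral `∫₀^∞ cosh (ν u) / cosh(u)^(k+1) du`. -/
def coshMoment (k ν : ℕ) : ℝ :=
  ∫ u in Ioi (0 : ℝ), Real.cosh (ν * u) / Real.cosh u ^ (k + 1)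

lemma cosh_natCast_mul_div_le {k ν : ℕ} (h : ν ≤ k) {u : ℝ} (hu : 0 ≤ u) :
    Real.cosh (ν * u) / Real.cosh u ^ (k + 1) ≤ 2 ^ (ν + 1) * Real.exp (-1 * u) := by
  have hc := Real.one_le_cosh u
  have hexp : Real.exp u ≤ 2 * Real.cosh u := by
    rw [Real.cosh_eq]
    linarith [Real.exp_pos (-u)]
  have h1 : Real.cosh (ν * u) ≤ (2 * Real.cosh u) ^ ν := by
    have h2 : Real.cosh (ν * u) ≤ Real.exp (ν * u) := by
      rw [Real.cosh_eq]
      have : Real.exp (-(ν * u)) ≤ Real.exp (ν * u) :=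
        Real.exp_le_exp.2 (neg_le_self (by positivity))
      linarith
    rw [Real.exp_nat_mul] at h2
    exact h2.trans (by gcongr)
  have h3 : Real.cosh u ^ (ν + 1) ≤ Real.cosh u ^ (k + 1) := pow_le_pow_right₀ hc (by lia)
  have hcp : 0 < Real.cosh u := Real.cosh_pos u
  calc Real.cosh (ν * u) / Real.cosh u ^ (k + 1)
      ≤ (2 * Real.cosh u) ^ ν / Real.cosh u ^ (ν + 1) := by gcongr
    _ = 2 ^ (ν + 1) * (1 / (2 * Real.cosh u)) := by
        rw [mul_pow, pow_succ, pow_succ]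
        field_simp
    _ ≤ 2 ^ (ν + 1) * (1 / Real.exp u) := by gcongr
    _ = 2 ^ (ν + 1) * Real.exp (-1 * u) := by rw [neg_one_mul, Real.exp_neg, one_div]

lemma continuous_cosh_div (k ν : ℕ) :
    Continuous fun u : ℝ => Real.cosh (ν * u) / Real.cosh u ^ (k + 1) :=
  (Real.continuous_cosh.comp (continuous_const.mul continuous_id)).div
    (Real.continuous_cosh.pow _) fun u => (pow_pos (Real.cosh_pos u) _).ne'

lemma integrableOn_cosh_div {k ν : ℕ} (h : ν ≤ k) :
    IntegrableOn (fun u : ℝ => Real.cosh (ν * u) / Real.cosh u ^ (k + 1)) (Ioi 0) := by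
  refine Integrable.mono' ((integrableOn_exp_mul_Ioi (neg_one_lt_zero) 0).const_mul (2 ^ (ν + 1)))
    (continuous_cosh_div k ν).aestronglyMeasurable
    ((ae_restrict_mem measurableSet_Ioi).mono fun u hu => ?_)
  have := Real.cosh_pos u
  have := Real.cosh_pos (ν * u)
  rw [Real.norm_of_nonneg (by positivity)]
  exact cosh_natCast_mul_div_le h (le_of_lt hu)

lemma coshMoment_add_two {k ν : ℕ} (h : ν + 1 ≤ k) :
    coshMoment (k + 1) (ν + 2) = 2 * coshMoment k (ν + 1) - coshMoment (k + 1) ν := by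
  unfold coshMoment
  rw [← integral_const_mul, ← integral_sub ((integrableOn_cosh_div h).const_mul 2)
    (integrableOn_cosh_div (by lia))]
  refine integral_congr_ae (.of_forall fun u => ?_)
  have hc := (Real.cosh_pos u).ne'
  have e1 : Real.cosh ((ν + 2 : ℕ) * u) = Real.cosh ((ν + 1 : ℕ) * u + u) := by
    congr 1; push_cast; ring
  have e2 : Real.cosh ((ν : ℕ) * u) = Real.cosh ((ν + 1 : ℕ) * u - u) := by
    congr 1; push_cast; ring
  simp only
  rw [e1, e2, Real.cosh_add, Real.cosh_sub, pow_succ _ (k + 1)]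
  field_simp
  ring

lemma coshMoment_succ_one (k : ℕ) : coshMoment (k + 1) 1 = coshMoment k 0 := by
  unfold coshMoment
  refine integral_congr_ae (.of_forall fun u => ?_)
  have hc := (Real.cosh_pos u).ne'
  simp only [Nat.cast_one, one_mul, Nat.cast_zero, zero_mul, Real.cosh_zero]
  rw [pow_succ _ (k + 1)]
  field_simp

lemma tendsto_sinh_atTop : Tendsto Real.sinh atTop atTop :=
  tendsto_atTop_mono' _ ((eventually_ge_atTop 0).mono fun _ hx => Real.self_le_sinh_iff.2 hx)
    tendsto_id

lemma coshMoment_zero_zero : coshMoment 0 0 = Real.pi / 2 := by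
  have h := integral_Ioi_of_hasDerivAt_of_tendsto (a := 0) (m := Real.pi / 2)
    (f := fun u => Real.arctan (Real.sinh u))
    (f' := fun u : ℝ => Real.cosh ((0 : ℕ) * u) / Real.cosh u ^ (0 + 1))
    (Real.continuous_arctan.comp Real.continuous_sinh).continuousWithinAt
    (fun u _ => ?_) (integrableOn_cosh_div le_rfl)
    ((tendsto_nhdsWithin_iff.1 Real.tendsto_arctan_atTop).1.comp tendsto_sinh_atTop)
  · simpa [coshMoment] using h
  · have hc := (Real.cosh_pos u).ne'
    refine ((Real.hasDerivAt_arctan _).comp u (Real.hasDerivAt_sinh u)).congr_deriv ?_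
    have := Real.cosh_sq' u
    rw [← this]
    simp
    field_simp

lemma coshMoment_zero_rec (k : ℕ) :
    (k + 2) * coshMoment (k + 2) 0 = (k + 1) * coshMoment k 0 := by
  have i1 := (integrableOn_cosh_div (Nat.zero_le (k + 2))).const_mul ((k : ℝ) + 2)
  have i2 := (integrableOn_cosh_div (Nat.zero_le k)).const_mul ((k : ℝ) + 1)
  have hlim : Tendsto (fun u : ℝ => Real.sinh u / Real.cosh u ^ (k + 2)) atTop (nhds 0) := by
    have hb : Tendsto (fun u : ℝ => 2 * Real.exp (-1 * u)) atTop (nhds 0) := by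
      have := (Real.tendsto_exp_neg_atTop_nhds_zero).const_mul 2
      simpa using this
    refine squeeze_zero_norm' ((eventually_ge_atTop 0).mono fun u hu => ?_) hb
    have hsinh : 0 ≤ Real.sinh u := Real.sinh_nonneg_iff.2 hu
    have hc := Real.cosh_pos u
    rw [Real.norm_of_nonneg (by positivity)]
    have h0 := cosh_natCast_mul_div_le (Nat.zero_le k) hu
    simp only [Nat.cast_zero, zero_mul, Real.cosh_zero, zero_add, pow_one] at h0
    refine le_trans ?_ h0
    rw [pow_succ _ (k + 1), div_le_div_iff₀ (by positivity) (by positivity)]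
    have := (Real.sinh_lt_cosh u).le
    have h2 : 0 < Real.cosh u ^ (k + 1) := by positivity
    nlinarith
  have h := integral_Ioi_of_hasDerivAt_of_tendsto (a := 0)
    (f := fun u => Real.sinh u / Real.cosh u ^ (k + 2))
    (f' := fun u : ℝ => ((k : ℝ) + 2) * (Real.cosh ((0 : ℕ) * u) / Real.cosh u ^ (k + 2 + 1)) -
      ((k : ℝ) + 1) * (Real.cosh ((0 : ℕ) * u) / Real.cosh u ^ (k + 1)))
    (Real.continuous_sinh.div (Real.continuous_cosh.pow _)
      fun u => (pow_pos (Real.cosh_pos u) _).ne').continuousWithinAt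
    (fun u _ => ?_) (i1.sub i2) hlim
  · rw [integral_sub i1 i2, integral_const_mul, integral_const_mul] at h
    simp only [Real.sinh_zero, zero_div, sub_zero] at h
    unfold coshMoment
    linarith
  · have hc := (Real.cosh_pos u).ne'
    refine ((Real.hasDerivAt_sinh u).div ((Real.hasDerivAt_cosh u).pow (k + 2))
      (pow_ne_zero _ hc)).congr_deriv ?_
    have hsq := Real.sinh_sq u
    simp only [Nat.cast_zero, zero_mul, Real.cosh_zero]
    simp only [show k + 2 - 1 = k + 1 by lia, Pi.pow_apply]
    push_cast
    rw [show (Real.cosh u * Real.cosh u ^ (k + 2) -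
      Real.sinh u * (((k : ℝ) + 2) * Real.cosh u ^ (k + 1) * Real.sinh u)) =
      Real.cosh u ^ (k + 3) - (k + 2) * Real.cosh u ^ (k + 1) * Real.sinh u ^ 2 by ring, hsq]
    field_simp
    ring

/-- The moments of `K_ν` and the Abel moments of `J_ν` agree up to a sign and `π / 2`. -/
lemma factorial_mul_coshMoment (ν m : ℕ) :
    ((ν + 2 * m).factorial : ℝ) * coshMoment (ν + 2 * m) ν =
      Real.pi / 2 * (-1) ^ m * besselMoment ν (ν + 2 * m) := by
  have hzero : ∀ m : ℕ, ((2 * m).factorial : ℝ) * coshMoment (2 * m) 0 =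
      Real.pi / 2 * (-1) ^ m * besselMoment 0 (2 * m) := by
    intro m
    induction m with
    | zero => simp [coshMoment_zero_zero, besselMoment_zero_right]
    | succ m ih =>
      have h1 := coshMoment_zero_rec (2 * m)
      have h2 := besselMoment_zero_succ (2 * m + 1)
      rw [show 2 * (m + 1) = 2 * m + 1 + 1 by ring, h2, Nat.factorial_succ, Nat.factorial_succ]
      simp only [add_tsub_cancel_right]
      push_cast at h1 ⊢
      rw [show 2 * m + 1 + 1 = 2 * m + 2 by ring, pow_succ]
      linear_combination (2 * (m : ℝ) + 1) * ((2 * m).factorial : ℝ) * h1 +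
        (2 * (m : ℝ) + 1) ^ 2 * ih
  induction ν using Nat.twoStepInduction generalizing m with
  | zero => simpa using hzero m
  | one =>
    have h := besselMoment_one (2 * m + 1)
    rw [show 1 + 2 * m = 2 * m + 1 by ring, coshMoment_succ_one, Nat.factorial_succ, h]
    simp only [add_tsub_cancel_right]
    push_cast
    rw [pow_succ (0 : ℝ), mul_zero]
    linear_combination (2 * (m : ℝ) + 1) * hzero m
  | more ν h0 h1 =>
    have h := besselMoment_add_two ν (ν + 1 + 2 * m + 1)
    have hc := coshMoment_add_two (k := ν + 1 + 2 * m) (ν := ν) (by lia)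
    have h0 := h0 (m + 1)
    have h1 := h1 m
    rw [show ν + 2 * (m + 1) = ν + 1 + 2 * m + 1 by ring, Nat.factorial_succ] at h0
    rw [show ν + 2 + 2 * m = ν + 1 + 2 * m + 1 by ring, hc, h, Nat.factorial_succ]
    simp only [add_tsub_cancel_right]
    push_cast at h0 ⊢
    rw [pow_succ] at h0
    linear_combination 2 * ((ν : ℝ) + 1 + 2 * m + 1) * h1 - h0

lemma integral_pow_mul_exp_neg_mul (k : ℕ) {r : ℝ} (hr : 0 < r) :
    ∫ t in Ioi (0 : ℝ), Real.exp (-r * t) * t ^ k = k.factorial / r ^ (k + 1) := by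
  have h := Real.integral_rpow_mul_exp_neg_mul_Ioi (a := (k : ℝ) + 1) (by positivity) hr
  rw [Real.Gamma_nat_eq_factorial] at h
  have e : (1 / r) ^ ((k : ℝ) + 1) = (1 / r) ^ (k + 1) := by
    rw [← Real.rpow_natCast]; push_cast; rfl
  rw [e] at h
  calc _ = ∫ t in Ioi (0 : ℝ), t ^ ((k : ℝ) + 1 - 1) * Real.exp (-(r * t)) := by
        refine integral_congr_ae (.of_forall fun t => ?_)
        simp only [add_sub_cancel_right, Real.rpow_natCast, neg_mul]
        ring
    _ = _ := by rw [h, one_div, inv_pow]; ring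

lemma integral_pow_mul_besselK {k ν : ℕ} (h : ν ≤ k) :
    ∫ t in Ioi (0 : ℝ), t ^ k * besselK ν t = k.factorial * coshMoment k ν := by
  have hin : ∀ u : ℝ, ∫ t in Ioi (0 : ℝ), t ^ k * (Real.exp (-t * Real.cosh u) * Real.cosh (ν * u))
      = k.factorial * (Real.cosh (ν * u) / Real.cosh u ^ (k + 1)) := by
    intro u
    have := integral_pow_mul_exp_neg_mul k (Real.cosh_pos u)
    rw [show (k.factorial : ℝ) * (Real.cosh (ν * u) / Real.cosh u ^ (k + 1)) =
      k.factorial / Real.cosh u ^ (k + 1) * Real.cosh (ν * u) by ring, ← this,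
      ← integral_mul_const]
    refine integral_congr_ae (.of_forall fun t => ?_)
    simp only
    rw [show -t * Real.cosh u = -Real.cosh u * t by ring]
    ring
  have hInt : Integrable (Function.uncurry fun t u : ℝ =>
      t ^ k * (Real.exp (-t * Real.cosh u) * Real.cosh (ν * u)))
      ((volume.restrict (Ioi (0 : ℝ))).prod (volume.restrict (Ioi (0 : ℝ)))) := by
    have hcont : Continuous (Function.uncurry fun t u : ℝ =>
        t ^ k * (Real.exp (-t * Real.cosh u) * Real.cosh (ν * u))) := by
      have := Real.continuous_cosh
      unfold Function.uncurry
      fun_prop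
    rw [integrable_prod_iff' hcont.aestronglyMeasurable]
    refine ⟨.of_forall fun u => ?_, ?_⟩
    · refine ((integrableOn_exp_mul_pow k (Real.cosh_pos u)).mul_const (Real.cosh (ν * u))).congr
        (.of_forall fun t => ?_)
      simp only [Function.uncurry]
      rw [show -t * Real.cosh u = -Real.cosh u * t by ring]
      ring
    · refine ((integrableOn_cosh_div h).const_mul (k.factorial : ℝ)).congr (.of_forall fun u => ?_)
      simp only
      rw [← hin u]
      refine setIntegral_congr_fun measurableSet_Ioi fun t ht => ?_
      have h1 : (0 : ℝ) ≤ t := le_of_lt ht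
      have h2 := Real.cosh_pos (ν * u)
      simp only [Function.uncurry]
      rw [Real.norm_of_nonneg (by positivity)]
  unfold coshMoment besselK
  rw [← integral_const_mul]
  simp_rw [← integral_const_mul (_ ^ k)]
  rw [integral_integral_swap hInt]
  exact integral_congr_ae (.of_forall fun u => hin u)

/-! ### Exactness on monomials -/

lemma integral_weightW_mul_pow {μ ν m : ℕ} (hνμ : ν ≤ μ) (heven : Even (μ - ν)) :
    ∫ x in Ioi (0 : ℝ), weightW μ ν x * x ^ m =
      ∫ t in Ioi (0 : ℝ), t ^ (μ + 2 * m) * besselK ν t := by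
  have hcond : ∃ j : ℤ, (μ : ℝ) - ν = 2 * j := by
    obtain ⟨p, hp⟩ := heven
    refine ⟨p, ?_⟩
    have : μ = ν + 2 * p := by lia
    rw [this]
    push_cast
    ring
  rw [← integral_comp_rpow_Ioi (fun t : ℝ => t ^ (μ + 2 * m) * besselK ν t)
    (show (1 / 2 : ℝ) ≠ 0 by norm_num)]
  refine setIntegral_congr_fun measurableSet_Ioi fun x hx => ?_
  rw [mem_Ioi] at hx
  simp only [weightW, if_pos hcond, smul_eq_mul]
  rw [← Real.sqrt_eq_rpow, abs_of_pos (by norm_num : (0 : ℝ) < 1 / 2)]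
  have h1 : Real.sqrt x ^ (μ + 2 * m) = x ^ ((μ : ℝ) / 2) * x ^ m := by
    rw [pow_add, pow_mul, Real.sq_sqrt hx.le, Real.sqrt_eq_rpow, ← Real.rpow_natCast,
      ← Real.rpow_mul hx.le]
    congr 2
    ring
  have h2 : x ^ (((μ : ℝ) - 1) / 2) = x ^ ((1 / 2 : ℝ) - 1) * x ^ ((μ : ℝ) / 2) := by
    rw [← Real.rpow_add hx]
    congr 1
    ring
  rw [h1, h2]
  ring

lemma besselMoment_eq_zero (ν j : ℕ) : besselMoment ν (ν + 2 * j + 1) = 0 := by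
  have : ((ν : ℝ) - (ν + 2 * j + 1 : ℕ) + 1) / 2 = -(j : ℝ) := by
    push_cast
    ring
  rw [besselMoment, this, Real.Gamma_neg_nat_eq_zero, div_zero]

/-- The Gaussian rule reproduces the Abel moments of order at least `μ`. -/
lemma gauss_moment {ν μ n : ℕ} (hνμ : ν ≤ μ) (heven : Even (μ - ν))
    {xs ws : Fin n → ℝ} (hG : IsGaussRule (μ : ℝ) (ν : ℝ) n xs ws) {k : ℕ} (hk : μ ≤ k)
    (hkn : k < 4 * n + μ) :
    2 / Real.pi * Real.cos (((k : ℝ) - ν) * Real.pi / 2) *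
      ∑ j, ws j * (xs j) ^ (((k : ℝ) - kappaQ μ ν) / 2) = besselMoment ν k := by
  obtain ⟨p, hp⟩ := heven
  have hμ : μ = ν + 2 * p := by lia
  rcases Nat.even_or_odd' (k - μ) with ⟨m, hm | hm⟩
  · have hkm : k = ν + 2 * (p + m) := by lia
    have hgauss := hG.2.2.2 (X ^ m) (by rw [natDegree_X_pow]; lia)
    simp only [eval_pow, eval_X] at hgauss
    rw [integral_weightW_mul_pow hνμ ⟨p, hp⟩, show μ + 2 * m = ν + 2 * (p + m) by lia,
      integral_pow_mul_besselK (by lia), factorial_mul_coshMoment] at hgauss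
    have hsum : ∑ j, ws j * (xs j) ^ (((k : ℝ) - kappaQ μ ν) / 2) = ∑ j, ws j * xs j ^ m := by
      refine Finset.sum_congr rfl fun j _ => ?_
      rw [← Real.rpow_natCast, kappaQ, if_pos ⟨p, hp⟩, show k = μ + 2 * m by lia]
      congr 2
      push_cast
      ring
    have hcos : Real.cos (((k : ℝ) - ν) * Real.pi / 2) = (-1) ^ (p + m) := by
      rw [← Real.cos_nat_mul_pi, hkm]
      congr 1
      push_cast
      ring
    have hsq : ((-1 : ℝ) ^ (p + m)) * (-1) ^ (p + m) = 1 := by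
      rw [← mul_pow]
      norm_num
    rw [hsum, hgauss, hcos, ← hkm]
    have := Real.pi_ne_zero
    field_simp
    linear_combination besselMoment ν k * hsq
  · have hkm : k = ν + 2 * (p + m) + 1 := by lia
    have hcos : Real.cos (((k : ℝ) - ν) * Real.pi / 2) = 0 := by
      rw [Real.cos_eq_zero_iff]
      refine ⟨((p + m : ℕ) : ℤ), ?_⟩
      rw [hkm]
      push_cast
      ring
    rw [hcos, hkm, besselMoment_eq_zero]
    simp

lemma iteratedDeriv_polynomial_eval_zero (f : ℂ[X]) (k : ℕ) :
    iteratedDeriv k (fun z => f.eval z) 0 = k.factorial * f.coeff k := by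
  have h : iteratedDeriv k (fun z => f.eval z) = fun z => (derivative^[k] f).eval z := by
    induction k with
    | zero => simp
    | succ k ih =>
      rw [iteratedDeriv_succ, ih, Function.iterate_succ_apply']
      funext z
      exact Polynomial.deriv _
  rw [h]
  simp only
  rw [← coeff_zero_eq_eval_zero, coeff_iterate_derivative, zero_add, Nat.descFactorial_self,
    nsmul_eq_mul]

lemma exp_mul_I_pow_add (ν k : ℕ) :
    Complex.exp (-(ν : ℂ) * (Real.pi : ℂ) * Complex.I / 2) * Complex.I ^ k +
      Complex.exp ((ν : ℂ) * (Real.pi : ℂ) * Complex.I / 2) * (-Complex.I) ^ k =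
      2 * ((Real.cos (((k : ℝ) - ν) * Real.pi / 2) : ℝ) : ℂ) := by
  have h1 : Complex.I ^ k = Complex.exp ((k : ℂ) * ((Real.pi : ℂ) / 2 * Complex.I)) := by
    rw [Complex.exp_nat_mul, Complex.exp_pi_div_two_mul_I]
  have h2 : (-Complex.I) ^ k = Complex.exp ((k : ℂ) * (-(Real.pi : ℂ) / 2 * Complex.I)) := by
    rw [Complex.exp_nat_mul, Complex.exp_neg_pi_div_two_mul_I]
  rw [h1, h2, ← Complex.exp_add, ← Complex.exp_add, Complex.ofReal_cos, Complex.two_cos]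
  push_cast
  congr 2 <;> ring

lemma QRule_eq_sum {ν μ n : ℕ} (hνμ : ν ≤ μ) (heven : Even (μ - ν))
    {xs ws : Fin n → ℝ} (hG : IsGaussRule (μ : ℝ) (ν : ℝ) n xs ws)
    {f : ℂ[X]} (hdeg : f.natDegree < 4 * n + μ) (ω : ℝ) :
    QRule μ ν xs ws (fun z => f.eval z) ω =
      ∑ k ∈ Finset.range (4 * n + μ),
        f.coeff k * (((ω ^ (k + 1))⁻¹ * besselMoment ν k : ℝ) : ℂ) := by
  set B : ℕ → ℝ := fun k => 2 / Real.pi * Real.cos (((k : ℝ) - ν) * Real.pi / 2) *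
      ∑ j, ws j * (xs j) ^ (((k : ℝ) - kappaQ μ ν) / 2) with hB
  have hbdry : ∀ k, ((wHat0 μ ν xs ws k : ℝ) : ℂ) / (ω : ℂ) ^ k *
      iteratedDeriv k (fun z => f.eval z) 0 =
      f.coeff k / (ω : ℂ) ^ k * ((besselMoment ν k - B k : ℝ) : ℂ) := by
    intro k
    have hf : (k.factorial : ℂ) ≠ 0 := by exact_mod_cast k.factorial_ne_zero
    have hw : wHat0 μ ν xs ws k = 1 / (k.factorial : ℝ) * (besselMoment ν k - B k) := rfl
    rw [iteratedDeriv_polynomial_eval_zero, hw]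
    push_cast
    field_simp
  have hnode : ∀ j, ((ws j * (xs j) ^ (-(kappaQ μ ν) / 2) / Real.pi : ℝ) : ℂ) *
          (Complex.exp (-(ν : ℂ) * (Real.pi : ℂ) * Complex.I / 2) *
              f.eval (Complex.I * (Real.sqrt (xs j) : ℂ) / (ω : ℂ))
            + Complex.exp ((ν : ℂ) * (Real.pi : ℂ) * Complex.I / 2) *
              f.eval (-Complex.I * (Real.sqrt (xs j) : ℂ) / (ω : ℂ))) =
      ∑ k ∈ Finset.range (4 * n + μ), f.coeff k / (ω : ℂ) ^ k *
        ((2 / Real.pi * Real.cos (((k : ℝ) - ν) * Real.pi / 2) *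
          (ws j * (xs j) ^ (((k : ℝ) - kappaQ μ ν) / 2)) : ℝ) : ℂ) := by
    intro j
    rw [eval_eq_sum_range' hdeg, eval_eq_sum_range' hdeg, Finset.mul_sum, Finset.mul_sum,
      ← Finset.sum_add_distrib, Finset.mul_sum]
    refine Finset.sum_congr rfl fun k _ => ?_
    have hx := hG.2.1 j
    have hpow : (xs j) ^ (((k : ℝ) - kappaQ μ ν) / 2) =
        (xs j) ^ (-(kappaQ μ ν) / 2) * Real.sqrt (xs j) ^ k := by
      rw [Real.sqrt_eq_rpow, ← Real.rpow_natCast, ← Real.rpow_mul hx.le, ← Real.rpow_add hx]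
      congr 1
      ring
    have he := exp_mul_I_pow_add ν k
    rw [hpow]
    simp only [div_pow, mul_pow]
    push_cast at he ⊢
    linear_combination (ws j * ((xs j ^ (-(kappaQ μ ν) / 2) : ℝ) : ℂ) / Real.pi * f.coeff k *
      (Real.sqrt (xs j) : ℂ) ^ k / (ω : ℂ) ^ k) * he
  have hnodes : ∑ j, ((ws j * (xs j) ^ (-(kappaQ μ ν) / 2) / Real.pi : ℝ) : ℂ) *
          (Complex.exp (-(ν : ℂ) * (Real.pi : ℂ) * Complex.I / 2) *
              f.eval (Complex.I * (Real.sqrt (xs j) : ℂ) / (ω : ℂ))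
            + Complex.exp ((ν : ℂ) * (Real.pi : ℂ) * Complex.I / 2) *
              f.eval (-Complex.I * (Real.sqrt (xs j) : ℂ) / (ω : ℂ))) =
      ∑ k ∈ Finset.range (4 * n + μ), f.coeff k / (ω : ℂ) ^ k * (B k : ℂ) := by
    rw [Finset.sum_congr rfl fun j _ => hnode j, Finset.sum_comm]
    refine Finset.sum_congr rfl fun k _ => ?_
    rw [hB, ← Finset.mul_sum, ← Complex.ofReal_sum, ← Finset.mul_sum]
  unfold QRule
  rw [Finset.sum_congr rfl fun k _ => hbdry k, hnodes, add_comm (4 * n) μ, Finset.sum_range_add,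
    Finset.sum_range_add, ← add_assoc, ← Finset.sum_add_distrib, mul_add, Finset.mul_sum,
    Finset.mul_sum]
  congr 1
  · refine Finset.sum_congr rfl fun k _ => ?_
    push_cast
    ring
  · refine Finset.sum_congr rfl fun i hi => ?_
    have hBm : B (μ + i) = besselMoment ν (μ + i) :=
      gauss_moment hνμ heven hG (by lia) (by have := Finset.mem_range.1 hi; lia)
    rw [hBm]
    push_cast
    ring

lemma exists_abs_besselNat_mul_le (ν : ℕ) {ω : ℝ} (hω : 0 < ω) :
    ∃ C, ∀ x, 0 ≤ x → |besselNat ν (ω * x)| ≤ C :=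
  (exists_abs_besselNat_le ν).imp fun _ hC _ hx => hC _ (by positivity)

lemma laplaceMoment_besselNat_mul (ν k : ℕ) {ω : ℝ} (hω : 0 < ω) (s : ℝ) :
    laplaceMoment (fun x => besselNat ν (ω * x)) k s =
      (ω ^ (k + 1))⁻¹ * laplaceMoment (besselNat ν) k (s / ω) := by
  have h := integral_comp_mul_left_Ioi
    (fun y : ℝ => Real.exp (-(s / ω) * y) * y ^ k * besselNat ν y) 0 hω
  rw [mul_zero, smul_eq_mul] at h
  unfold laplaceMoment
  rw [pow_succ, mul_inv, mul_assoc, ← h, ← integral_const_mul]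
  refine integral_congr_ae (.of_forall fun x => ?_)
  simp only
  rw [mul_pow, show -(s / ω) * (ω * x) = -s * x by field_simp]
  field_simp

lemma hasAbelLimit_polynomial_mul_besselJ (ν : ℕ) {f : ℂ[X]} {N : ℕ} (hdeg : f.natDegree < N)
    {ω : ℝ} (hω : 0 < ω) :
    HasAbelLimit (fun x : ℝ => f.eval (x : ℂ) * ((besselJ ν (ω * x) : ℝ) : ℂ))
      (∑ k ∈ Finset.range N, f.coeff k * (((ω ^ (k + 1))⁻¹ * besselMoment ν k : ℝ) : ℂ)) := by
  have hexpand : ∀ s : ℝ, (fun x : ℝ => Complex.exp (-(s : ℂ) * (x : ℂ)) *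
      (f.eval (x : ℂ) * ((besselJ ν (ω * x) : ℝ) : ℂ))) = fun x : ℝ =>
      ∑ k ∈ Finset.range N, f.coeff k *
        ((Real.exp (-s * x) * x ^ k * besselNat ν (ω * x) : ℝ) : ℂ) := by
    intro s
    funext x
    rw [besselJ_natCast, eval_eq_sum_range' hdeg, Finset.sum_mul, Finset.mul_sum]
    refine Finset.sum_congr rfl fun k _ => ?_
    push_cast
    ring
  have hInt : ∀ s : ℝ, 0 < s → ∀ k ∈ Finset.range N, IntegrableOn (fun x : ℝ => f.coeff k *
      ((Real.exp (-s * x) * x ^ k * besselNat ν (ω * x) : ℝ) : ℂ)) (Ioi 0) := by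
    intro s hs k _
    exact (integrableOn_laplace ((continuous_besselNat ν).comp (continuous_const.mul continuous_id))
      (exists_abs_besselNat_mul_le ν hω) k hs).ofReal.const_mul _
  refine ⟨fun s hs => ?_, ?_⟩
  · rw [hexpand s]
    exact integrable_finsetSum _ (hInt s hs)
  · have hscale : Tendsto (fun s : ℝ => s / ω) (nhdsWithin 0 (Ioi 0)) (nhdsWithin 0 (Ioi 0)) := by
      refine tendsto_nhdsWithin_iff.2 ⟨?_, eventually_mem_nhdsWithin.mono fun s hs => ?_⟩
      · simpa using tendsto_id_nhdsGT_zero.div_const ω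
      · exact div_pos hs hω
    have hlim := tendsto_finsetSum (Finset.range N) fun k _ =>
      ((Complex.continuous_ofReal.tendsto _).comp
        (((tendsto_laplaceMoment_besselNat ν k).comp hscale).const_mul
          ((ω ^ (k + 1))⁻¹))).const_mul (f.coeff k)
    refine hlim.congr' (eventually_mem_nhdsWithin.mono fun s hs => ?_)
    beta_reduce
    rw [hexpand s, integral_finsetSum _ (hInt s hs)]
    refine Finset.sum_congr rfl fun k _ => ?_
    rw [integral_const_mul, integral_complex_ofReal]
    simp only [Function.comp_apply]
    rw [← laplaceMoment_besselNat_mul ν k hω]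
    rfl

/-- exactness of the generalized Gauss–Radau rule, `μ - ν` even. -/
theorem gaussRadau_exact_even (ν μ n : ℕ) (hνμ : ν ≤ μ) (heven : Even (μ - ν)) (hn : 1 ≤ n)
    (xs ws : Fin n → ℝ) (hG : IsGaussRule (μ : ℝ) (ν : ℝ) n xs ws)
    (f : Polynomial ℂ) (hdeg : f.natDegree ≤ 4 * n + μ - 1) (ω : ℝ) (hω : 0 < ω) :
    HasAbelLimit (fun x : ℝ => f.eval (x : ℂ) * ((besselJ ν (ω * x) : ℝ) : ℂ))
      (QRule μ ν xs ws (fun z => f.eval z) ω) := by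
  have hdeg' : f.natDegree < 4 * n + μ := by lia
  rw [QRule_eq_sum hνμ heven hG hdeg' ω]
  exact hasAbelLimit_polynomial_mul_besselJ ν hdeg' hω

end
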